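/- For any i, j ∈ [n], we have [t_i, t_j]^{⌈(n−j)/2⌉ + 1} = 0 in k[S_n], where ⌈x⌉ denotes the smallest integer ≥ x. -/

import Mathlib

/-- The simple transposition `s_i ∈ S_n` (1-based indexing), swapping `i` and `i+1`,
defined as the identity for `i` outside `{1, …, n-1}`. -/
def simpleTransposition (n i : ℕ) : Equiv.Perm (Fin n) :=
  if h : 1 ≤ i ∧ i < n then
    Equiv.swap ⟨i - 1, by omega⟩ ⟨i, h.2⟩
  else 1

/-- The cycle `(v ⟹ w) = s_v s_{v+1} ⋯ s_{w-1} ∈ S_n`, sending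
`v ↦ v+1 ↦ ⋯ ↦ w ↦ v` (and equal to the identity when `v = w`). -/
def cyc (n v w : ℕ) : Equiv.Perm (Fin n) :=
  ((List.range' v (w - v)).map (simpleTransposition n)).prod

/-- The somewhere-to-below shuffle `t_ℓ = Σ_{w=ℓ}^{n} (ℓ ⟹ w)` in the group
algebra `R[S_n]`. -/
noncomputable def t (R : Type*) [CommRing R] (n ℓ : ℕ) :
    MonoidAlgebra R (Equiv.Perm (Fin n)) :=
  ∑ w ∈ Finset.Icc ℓ n, MonoidAlgebra.of R (Equiv.Perm (Fin n)) (cyc n ℓ w)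

lemma simpleTransposition_mul_self (n i : ℕ) :
    simpleTransposition n i * simpleTransposition n i = 1 := by
  unfold simpleTransposition
  split_ifs <;> simp

lemma simpleTransposition_of_le {n i : ℕ} (h : n ≤ i) : simpleTransposition n i = 1 :=
  dif_neg (by omega)

lemma simpleTransposition_commute (n : ℕ) {i j : ℕ} (h : i + 2 ≤ j) :
    Commute (simpleTransposition n i) (simpleTransposition n j) := by
  unfold simpleTransposition
  split_ifs
  · exact (Equiv.Perm.disjoint_swap_swap (by
      simp
      omega)).commute
  all_goals simp

lemma simpleTransposition_braid {n i : ℕ} (hi : 1 ≤ i) (h : i + 2 ≤ n) :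
    simpleTransposition n i * simpleTransposition n (i + 1) * simpleTransposition n i =
      simpleTransposition n (i + 1) * simpleTransposition n i *
        simpleTransposition n (i + 1) := by
  have h₁ : 1 ≤ i ∧ i < n := by omega
  have h₂ : 1 ≤ i + 1 ∧ i + 1 < n := by omega
  simp only [simpleTransposition, dif_pos h₁, dif_pos h₂, Nat.add_sub_cancel]
  have braid {a b c : Fin n} (hab : a ≠ b) (hbc : b ≠ c) (hac : a ≠ c) :
      Equiv.swap a b * Equiv.swap b c * Equiv.swap a b =
        Equiv.swap b c * Equiv.swap a b * Equiv.swap b c := by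
    rw [Equiv.swap_mul_swap_mul_swap hab hac, Equiv.swap_comm a b, Equiv.swap_comm b c,
      Equiv.swap_mul_swap_mul_swap hbc.symm hac.symm, Equiv.swap_comm]
  apply braid <;> simp only [ne_eq, Fin.mk.injEq] <;> omega

section Shuffles

variable (R : Type*) [CommRing R] (n : ℕ)

/-- The simple transposition `s_i` as an element of the group algebra. -/
noncomputable def simpleElt (i : ℕ) : MonoidAlgebra R (Equiv.Perm (Fin n)) :=
  MonoidAlgebra.of R (Equiv.Perm (Fin n)) (simpleTransposition n i)

/-- The product `(s_j - 1) (s_{j+2} - 1) ⋯ (s_{j+2(r-1)} - 1)`. -/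
noncomputable def antisymProd : ℕ → ℕ → MonoidAlgebra R (Equiv.Perm (Fin n))
  | _, 0 => 1
  | j, r + 1 => (simpleElt R n j - 1) * antisymProd (j + 2) r

lemma simpleElt_mul_self (i : ℕ) : simpleElt R n i * simpleElt R n i = 1 := by
  rw [simpleElt, ← map_mul, simpleTransposition_mul_self, map_one]

lemma simpleElt_commute {i j : ℕ} (h : i + 2 ≤ j) :
    Commute (simpleElt R n i) (simpleElt R n j) :=
  (simpleTransposition_commute n h).map _

lemma t_eq_zero {j : ℕ} (h : n < j) : t R n j = 0 := by
  simp [t, Finset.Icc_eq_empty_of_lt h]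

lemma t_eq_one_add {j : ℕ} (h : j ≤ n) :
    t R n j = 1 + simpleElt R n j * t R n (j + 1) := by
  unfold t simpleElt
  rw [← Finset.insert_Icc_add_one_left_eq_Icc h, Finset.sum_insert (by simp), Finset.mul_sum]
  congr 1
  · simp [cyc, MonoidAlgebra.one_def]
  · refine Finset.sum_congr rfl fun w hw => ?_
    have hw' : w - j = (w - (j + 1)) + 1 := by
      have := (Finset.mem_Icc.mp hw).1
      omega
    rw [← map_mul, cyc, cyc, hw', List.range'_succ, List.map_cons, List.prod_cons]

lemma commute_t_of_commute_simpleElt {x : MonoidAlgebra R (Equiv.Perm (Fin n))} {j : ℕ}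
    (hx : ∀ u, j ≤ u → Commute x (simpleElt R n u)) : Commute x (t R n j) := by
  rcases lt_or_ge n j with h | h
  · rw [t_eq_zero R n h]
    exact Commute.zero_right x
  · induction h using Nat.decreasingInduction with
    | self =>
      rw [t_eq_one_add R n le_rfl, t_eq_zero R n n.lt_succ_self, mul_zero, add_zero]
      exact Commute.one_right x
    | of_succ k hk ih =>
      rw [t_eq_one_add R n hk.le]
      exact (Commute.one_right x).add_right
        ((hx k le_rfl).mul_right (ih fun u hu => hx u (by omega)))

lemma commute_antisymProd_of_commute_simpleElt {x : MonoidAlgebra R (Equiv.Perm (Fin n))}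
    {j : ℕ} (hx : ∀ u, j ≤ u → Commute x (simpleElt R n u)) (r : ℕ) :
    Commute x (antisymProd R n j r) := by
  induction r generalizing j with
  | zero => exact Commute.one_right x
  | succ r ih =>
    exact ((hx j le_rfl).sub_right (Commute.one_right x)).mul_right
      (ih fun u hu => hx u (by omega))

lemma antisymProd_eq_zero {j r : ℕ} (h : n ≤ j + 2 * r) :
    antisymProd R n j (r + 1) = 0 := by
  induction r generalizing j with
  | zero => simp [antisymProd, simpleElt, simpleTransposition_of_le (show n ≤ j by omega),
      MonoidAlgebra.one_def]
  | succ r ih => rw [antisymProd, ih (by omega), mul_zero]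

lemma simpleElt_braid_mul_t {j : ℕ} (hj : 1 ≤ j) :
    simpleElt R n j * simpleElt R n (j + 1) * simpleElt R n j * t R n (j + 2) =
      simpleElt R n (j + 1) * simpleElt R n j * simpleElt R n (j + 1) * t R n (j + 2) := by
  rcases lt_or_ge n (j + 2) with h | h
  · simp [t_eq_zero R n h]
  · simp only [simpleElt, ← map_mul, simpleTransposition_braid hj h]

lemma simpleElt_mul_t_succ_mul_t {j : ℕ} (hj : 1 ≤ j) :
    simpleElt R n j * (t R n (j + 1) * t R n j) = t R n (j + 1) * t R n j := by
  rcases lt_or_ge n j with h | h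
  · simp [t_eq_zero R n h]
  · induction h using Nat.decreasingInduction with
    | self => simp [t_eq_zero R n n.lt_succ_self]
    | of_succ j hjn ih =>
      have ih := ih (by omega)
      have ha := t_eq_one_add R n (j := j + 1) hjn
      have hs := simpleElt_mul_self R n j
      have hb : Commute (simpleElt R n j) (t R n (j + 2)) :=
        commute_t_of_commute_simpleElt R n fun u hu => simpleElt_commute R n hu
      have hbraid := simpleElt_braid_mul_t R n hj
      rw [t_eq_one_add R n hjn.le]
      rw [show j + 1 + 1 = j + 2 from rfl] at ih ha
      set a := t R n (j + 1)
      set b := t R n (j + 2)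
      set s := simpleElt R n j
      set r := simpleElt R n (j + 1)
      have key : a * (1 + s * a) = a + s * a + r * s * (b * a) := by
        calc a * (1 + s * a) = a + (1 + r * b) * (s * a) := by rw [← ha]; noncomm_ring
          _ = a + s * a + r * (b * s) * a := by noncomm_ring
          _ = a + s * a + r * s * (b * a) := by rw [← hb.eq]; noncomm_ring
      have inv : s * (r * s * (b * a)) = r * s * (b * a) := by
        calc s * (r * s * (b * a)) = s * r * s * b * a := by noncomm_ring
          _ = r * s * (r * (b * a)) := by rw [hbraid]; noncomm_ring
          _ = r * s * (b * a) := by rw [ih]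
      rw [key, mul_add, mul_add, inv, ← mul_assoc s s, hs, one_mul, add_comm a]

lemma t_mul_simpleElt_sub_one {j : ℕ} (hj : 1 ≤ j) :
    t R n j * (simpleElt R n j - 1) =
      (simpleElt R n (j + 1) - 1) *
        (simpleElt R n j * simpleElt R n (j + 1) * t R n (j + 2)) := by
  rcases lt_or_ge j n with h | h
  · have hs := simpleElt_mul_self R n j
    have hb : Commute (simpleElt R n j) (t R n (j + 2)) :=
      commute_t_of_commute_simpleElt R n fun u hu => simpleElt_commute R n hu
    have hbraid := simpleElt_braid_mul_t R n hj
    rw [t_eq_one_add R n h.le, t_eq_one_add R n (j := j + 1) h,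
      show j + 1 + 1 = j + 2 from rfl]
    set b := t R n (j + 2)
    set s := simpleElt R n j
    set r := simpleElt R n (j + 1)
    calc (1 + s * (1 + r * b)) * (s - 1)
        = s * s - 1 + s * r * (b * s) - s * r * b := by noncomm_ring
      _ = s * r * s * b - s * r * b := by rw [hs, ← hb.eq]; noncomm_ring
      _ = (r - 1) * (s * r * b) := by rw [hbraid]; noncomm_ring
  · simp [simpleElt, simpleTransposition_of_le h,
      simpleTransposition_of_le (show n ≤ j + 1 by omega), MonoidAlgebra.one_def]

lemma antisymProd_succ_dvd_t_mul {j : ℕ} (hj : 1 ≤ j) (r : ℕ) :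
    antisymProd R n (j + 1) r ∣ t R n j * antisymProd R n j r := by
  induction r generalizing j with
  | zero => exact one_dvd _
  | succ r ih =>
    obtain ⟨y, hy⟩ := ih (j := j + 2) (by omega)
    have hc : Commute (simpleElt R n j * simpleElt R n (j + 1))
        (antisymProd R n (j + 1 + 2) r) :=
      commute_antisymProd_of_commute_simpleElt R n (fun u hu =>
        (simpleElt_commute R n (by omega)).mul_left (simpleElt_commute R n (by omega))) r
    refine ⟨simpleElt R n j * simpleElt R n (j + 1) * y, ?_⟩
    rw [antisymProd, antisymProd, ← mul_assoc, t_mul_simpleElt_sub_one R n hj]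
    calc _ = (simpleElt R n (j + 1) - 1) * (simpleElt R n j * simpleElt R n (j + 1) *
          (t R n (j + 2) * antisymProd R n (j + 2) r)) := by simp only [mul_assoc]
      _ = (simpleElt R n (j + 1) - 1) * ((simpleElt R n j * simpleElt R n (j + 1) *
          antisymProd R n (j + 1 + 2) r) * y) := by rw [hy]; simp only [mul_assoc]
      _ = _ := by rw [hc.eq]; simp only [mul_assoc]

lemma exists_t_eq_add_mul {i j : ℕ} (hij : i < j) (hj : j ≤ n) :
    ∃ p c : MonoidAlgebra R (Equiv.Perm (Fin n)), t R n i = p + c * t R n j ∧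
      (∀ u, j ≤ u → Commute p (simpleElt R n u)) ∧
      ∀ u, j + 1 ≤ u → Commute c (simpleElt R n u) := by
  obtain ⟨m, rfl⟩ : ∃ m, j = m + 1 := ⟨j - 1, by omega⟩
  have him : i ≤ m := by omega
  induction him using Nat.decreasingInduction with
  | self =>
    exact ⟨1, simpleElt R n m, t_eq_one_add R n (by omega), fun u _ => Commute.one_left _,
      fun u hu => simpleElt_commute R n hu⟩
  | of_succ k hk ih =>
    obtain ⟨p, c, ht, hp, hc⟩ := ih (by omega)
    refine ⟨1 + simpleElt R n k * p, simpleElt R n k * c, ?_, fun u hu => ?_, fun u hu => ?_⟩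
    · rw [t_eq_one_add R n (by omega), ht]
      noncomm_ring
    · exact (Commute.one_left _).add_left
        ((simpleElt_commute R n (by omega)).mul_left (hp u hu))
    · exact (simpleElt_commute R n (by omega)).mul_left (hc u hu)

lemma exists_commutator_t_eq {i j : ℕ} (hij : i < j) (hjn : j ≤ n) :
    ∃ c : MonoidAlgebra R (Equiv.Perm (Fin n)),
      (∀ u, j + 1 ≤ u → Commute c (simpleElt R n u)) ∧
      t R n i * t R n j - t R n j * t R n i =
        (simpleElt R n j - 1) * (-c * (t R n (j + 1) * t R n j)) := by
  obtain ⟨p, c, ht, hp, hc⟩ := exists_t_eq_add_mul R n hij hjn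
  refine ⟨c, hc, ?_⟩
  have hpt := (commute_t_of_commute_simpleElt R n hp).eq
  have hct := (commute_t_of_commute_simpleElt R n hc).eq
  have hinv := simpleElt_mul_t_succ_mul_t R n (j := j) (by omega)
  have hsq : t R n j * t R n j = t R n j + t R n (j + 1) * t R n j := by
    conv_lhs => enter [1]; rw [t_eq_one_add R n hjn]
    rw [add_mul, one_mul, mul_assoc, hinv]
  have hrec := t_eq_one_add R n hjn
  calc t R n i * t R n j - t R n j * t R n i
      = (p * t R n j - t R n j * p) + c * (t R n j * t R n j) - t R n j * (c * t R n j) := by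
        rw [ht]; noncomm_ring
    _ = c * t R n j + c * t R n (j + 1) * t R n j
          - (1 + simpleElt R n j * t R n (j + 1)) * (c * t R n j) := by
        rw [hpt, hsq, ← hrec]; noncomm_ring
    _ = c * t R n (j + 1) * t R n j
          - simpleElt R n j * (t R n (j + 1) * c) * t R n j := by noncomm_ring
    _ = _ := by rw [← hct]; noncomm_ring

lemma antisymProd_dvd_commutator_t_mul {i j : ℕ} (hij : i < j) (hjn : j ≤ n) (r : ℕ) :
    antisymProd R n j (r + 1) ∣
      (t R n i * t R n j - t R n j * t R n i) * antisymProd R n j r := by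
  obtain ⟨c, hc, hD⟩ := exists_commutator_t_eq R n hij hjn
  obtain ⟨y, hy⟩ := antisymProd_succ_dvd_t_mul R n (j := j) (by omega) r
  obtain ⟨z, hz⟩ := antisymProd_succ_dvd_t_mul R n (j := j + 1) (by omega) r
  have hcQ : Commute (-c) (antisymProd R n (j + 2) r) :=
    (commute_antisymProd_of_commute_simpleElt R n (fun u hu => hc u (by omega)) r).neg_left
  refine ⟨-c * (z * y), ?_⟩
  rw [hD, antisymProd]
  calc _ = (simpleElt R n j - 1) * (-c *
        (t R n (j + 1) * (t R n j * antisymProd R n j r))) := by simp only [mul_assoc]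
    _ = (simpleElt R n j - 1) * (-c *
        (t R n (j + 1) * antisymProd R n (j + 1) r * y)) := by rw [hy]; simp only [mul_assoc]
    _ = (simpleElt R n j - 1) * (-c * antisymProd R n (j + 2) r * (z * y)) := by
        rw [hz]; simp only [mul_assoc]
    _ = _ := by rw [hcQ.eq]; simp only [mul_assoc]

lemma antisymProd_dvd_commutator_t_pow {i j : ℕ} (hij : i < j) (hjn : j ≤ n) (r : ℕ) :
    antisymProd R n j r ∣ (t R n i * t R n j - t R n j * t R n i) ^ r := by
  induction r with
  | zero => exact one_dvd _
  | succ r ih =>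
    obtain ⟨y, hy⟩ := ih
    rw [pow_succ', hy, ← mul_assoc]
    exact (antisymProd_dvd_commutator_t_mul R n hij hjn r).mul_right y

lemma commutator_t_pow_eq_zero {i j m : ℕ} (hij : i < j) (hjn : j ≤ n) (hm : n ≤ j + 2 * m) :
    (t R n i * t R n j - t R n j * t R n i) ^ (m + 1) = 0 := by
  have h := antisymProd_dvd_commutator_t_pow R n hij hjn (m + 1)
  rwa [antisymProd_eq_zero R n hm, zero_dvd_iff] at h

end Shuffles

theorem somewhere_to_below_right_bound
    (R : Type*) [CommRing R] (n : ℕ) (hn : 0 < n)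
    (i j : ℕ) (hi1 : 1 ≤ i) (hin : i ≤ n) (hj1 : 1 ≤ j) (hjn : j ≤ n) :
    (t R n i * t R n j - t R n j * t R n i) ^ ((n - j + 1) / 2 + 1) = 0 := by
  rcases lt_trichotomy i j with h | rfl | h
  · exact commutator_t_pow_eq_zero R n h hjn (by omega)
  · simp
  · rw [← neg_sub, neg_pow, commutator_t_pow_eq_zero R n h hin (by omega), mul_zero]
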